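/- Under Assumptions 1–4, the SACS algorithm (SOGD experts over CGC intervals combined by AdaNormalHedge) satisfies: for any interval [r, s] ⊆ [T] and any w ∈ W, Σ_{t=r}^s [f_t(w_t) − f_t(w)] ≤ v·a(s) + √(v·b(s)·Σ_{t=r}^s f_t(w)), where v ≤ ⌈log₂(s − r + 2)⌉, a(s) = (9/2) ln(4s²) + 18 H D² + 2D√(2δ), and b(s) = 24 ln(4s²) + 16 H D². -/

import Mathlib

/-- The AdaNormalHedge potential: `Φ(R, C) = exp([R]₊²/(3C))` for `C > 0` and `Φ(R, 0) = 1`. -/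
noncomputable def anhPhi (R C : ℝ) : ℝ :=
  if 0 < C then Real.exp (max R 0 ^ 2 / (3 * C)) else 1

/-- The AdaNormalHedge weight: `w(R, C) = (Φ(R+1, C+1) − Φ(R−1, C+1))/2`. -/
noncomputable def anhWeight (R C : ℝ) : ℝ :=
  (anhPhi (R + 1) (C + 1) - anhPhi (R - 1) (C + 1)) / 2

/-- The right endpoint `e i` of the unique compact geometric covering (CGC) interval
`[i, e i] ∈ 𝒞` with left endpoint `i ≥ 1`. -/
def cgcEnd (i : ℕ) : ℕ := i + 2 ^ padicValNat 2 i - 1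

/-- The active set `S t = { i : i ≤ t ≤ e i }` of experts at round `t`. -/
def activeSet (t : ℕ) : Finset ℕ := (Finset.Icc 1 t).filter fun i => t ≤ cgcEnd i


lemma anhPhi_eq_exp {C : ℝ} (hC : 0 ≤ C) (R : ℝ) :
    anhPhi R C = Real.exp (max R 0 ^ 2 / (3 * C)) := by
  unfold anhPhi
  split_ifs with h
  · rfl
  · obtain rfl : C = 0 := le_antisymm (not_lt.mp h) hC
    simp

lemma one_le_anhPhi (R C : ℝ) : 1 ≤ anhPhi R C := by
  unfold anhPhi
  split_ifs with h
  · exact Real.one_le_exp (by positivity)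
  · exact le_rfl

lemma anhPhi_mono {C R R' : ℝ} (h : R ≤ R') : anhPhi R C ≤ anhPhi R' C := by
  unfold anhPhi
  split_ifs with hC
  · gcongr
  · exact le_rfl

lemma anhWeight_nonneg (R C : ℝ) : 0 ≤ anhWeight R C := by
  have : anhPhi (R - 1) (C + 1) ≤ anhPhi (R + 1) (C + 1) := anhPhi_mono (by linarith)
  unfold anhWeight
  linarith

lemma anhWeight_zero_zero_pos : 0 < anhWeight 0 0 := by
  have h : (1 : ℝ) < Real.exp (1 / 3) := Real.one_lt_exp_iff.mpr (by norm_num)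
  norm_num [anhWeight, anhPhi] at h ⊢

/-- Convexity of `(R, C) ↦ [R]₊² / C`, in the form of an inequality between fractions. -/
lemma max_add_sq_div_le {x y a b : ℝ} (ha : 0 ≤ a) (hb : 0 < b) (hxa : x ≤ a) :
    max (x + y) 0 ^ 2 / (3 * (a + b)) ≤ max x 0 ^ 2 / (3 * a) + max y 0 ^ 2 / (3 * b) := by
  have hle : max (x + y) 0 ≤ max x 0 + max y 0 :=
    max_le (add_le_add (le_max_left _ _) (le_max_left _ _)) (by positivity)
  have hsq : max (x + y) 0 ^ 2 ≤ (max x 0 + max y 0) ^ 2 := by gcongr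
  have hX : 0 ≤ max x 0 := le_max_right _ _
  have hY : 0 ≤ max y 0 := le_max_right _ _
  rcases ha.eq_or_lt with rfl | ha
  · have : max x 0 = 0 := max_eq_right hxa
    rw [this] at hsq ⊢
    simp only [zero_add] at hsq ⊢
    norm_num
    gcongr
  · generalize max x 0 = X at *
    generalize max y 0 = Y at *
    calc max (x + y) 0 ^ 2 / (3 * (a + b)) ≤ (X + Y) ^ 2 / (3 * (a + b)) := by gcongr
      _ ≤ X ^ 2 / (3 * a) + Y ^ 2 / (3 * b) := by
        rw [div_add_div _ _ (by positivity) (by positivity),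
          div_le_div_iff₀ (by positivity) (by positivity)]
        nlinarith [sq_nonneg (X * b - Y * a), mul_pos ha hb]

lemma anhPhi_interpolate_le {R R' C θ : ℝ} (hC : 0 ≤ C) (hR : R ≤ C)
    (h0 : 0 ≤ θ) (h1 : θ ≤ 1) :
    anhPhi ((1 - θ) * R + θ * R') (C + θ) ≤
      (1 - θ) * anhPhi R C + θ * anhPhi R' (C + 1) := by
  rcases h0.eq_or_lt with rfl | h0
  · simp
  rw [anhPhi_eq_exp hC, anhPhi_eq_exp (by linarith), anhPhi_eq_exp (by linarith)]
  have hscale : ∀ (k x y : ℝ), 0 ≤ k → max (k * x) 0 ^ 2 / (3 * (k * y)) =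
      k * (max x 0 ^ 2 / (3 * y)) := by
    intro k x y hk
    rcases hk.eq_or_lt with rfl | hk
    · simp
    · rw [show max (k * x) 0 = k * max x 0 by rw [mul_max_of_nonneg _ _ hk.le, mul_zero]]
      field_simp
  have key := max_add_sq_div_le (x := (1 - θ) * R) (y := θ * R') (a := (1 - θ) * C)
    (b := θ * (C + 1)) (mul_nonneg (by linarith) hC) (by positivity)
    (mul_le_mul_of_nonneg_left hR (by linarith))
  rw [hscale _ _ _ (by linarith), hscale _ _ _ h0.le,
    show (1 - θ) * C + θ * (C + 1) = C + θ by ring] at key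
  refine (Real.exp_le_exp.mpr key).trans ?_
  have := convexOn_exp.2 (Set.mem_univ (max R 0 ^ 2 / (3 * C)))
    (Set.mem_univ (max R' 0 ^ 2 / (3 * (C + 1)))) (by linarith : 0 ≤ 1 - θ) h0.le (by ring)
  simpa [smul_eq_mul] using this

lemma exp_sub_exp_le (a b : ℝ) : Real.exp a - Real.exp b ≤ Real.exp a * (a - b) := by
  have h := Real.add_one_le_exp (b - a)
  have h2 : Real.exp b = Real.exp a * Real.exp (b - a) := by rw [← Real.exp_add]; congr 1; ring
  nlinarith [Real.exp_pos a]

lemma anhPhi_average_le {R C : ℝ} (hRC : |R| ≤ C) :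
    (anhPhi (R + 1) (C + 1) + anhPhi (R - 1) (C + 1)) / 2 ≤ anhPhi R C + 3 / 2 := by
  obtain ⟨hR1, hR2⟩ := abs_le.mp hRC
  have hC : 0 ≤ C := (abs_nonneg R).trans hRC
  have he : Real.exp 1 < 2.7182818286 := Real.exp_one_lt_d9
  rcases lt_or_ge R 1 with hR | hR
  · have h1 : anhPhi (R - 1) (C + 1) = 1 := by
      rw [anhPhi_eq_exp (by linarith), max_eq_right (by linarith)]
      simp
    have h2 : anhPhi (R + 1) (C + 1) ≤ Real.exp 1 := by
      rw [anhPhi_eq_exp (by linarith)]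
      refine Real.exp_le_exp.mpr ?_
      rw [div_le_one (by positivity)]
      rcases le_total (R + 1) 0 with h | h
      · rw [max_eq_right h]; nlinarith
      · rw [max_eq_left h]; nlinarith
    linarith [one_le_anhPhi R C]
  · rw [anhPhi_eq_exp hC, anhPhi_eq_exp (by linarith), anhPhi_eq_exp (by linarith),
      max_eq_left (by linarith), max_eq_left (by linarith), max_eq_left (by linarith)]
    have hC1 : 1 ≤ C := hR.trans hR2
    set c := C + 1 with hc
    have hcpos : 0 < c := by linarith
    have hcosh : (Real.exp ((R + 1) ^ 2 / (3 * c)) + Real.exp ((R - 1) ^ 2 / (3 * c))) / 2 ≤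
        Real.exp ((R ^ 2 + 1) / (3 * c) + 2 * R ^ 2 / (9 * c ^ 2)) := by
      have h1 : (R + 1) ^ 2 / (3 * c) = (R ^ 2 + 1) / (3 * c) + 2 * R / (3 * c) := by ring
      have h2 : (R - 1) ^ 2 / (3 * c) = (R ^ 2 + 1) / (3 * c) + -(2 * R / (3 * c)) := by ring
      have h3 : 2 * R ^ 2 / (9 * c ^ 2) = (2 * R / (3 * c)) ^ 2 / 2 := by field_simp; norm_num
      rw [h1, h2, h3, Real.exp_add, Real.exp_add, Real.exp_add]
      have := Real.cosh_le_exp_half_sq (2 * R / (3 * c))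
      rw [Real.cosh_eq] at this
      nlinarith [Real.exp_pos ((R ^ 2 + 1) / (3 * c))]
    have hgap : (R ^ 2 + 1) / (3 * c) + 2 * R ^ 2 / (9 * c ^ 2) - R ^ 2 / (3 * C) ≤
        1 / (3 * c) - R ^ 2 / (9 * c ^ 2) := by
      have h1 : R ^ 2 / (3 * C) - R ^ 2 / (3 * c) = R ^ 2 / (3 * (C * c)) := by
        rw [hc]; field_simp; ring
      have h2 : R ^ 2 / (3 * c ^ 2) ≤ R ^ 2 / (3 * (C * c)) := by
        gcongr
        nlinarith
      have h3 : R ^ 2 / (3 * c ^ 2) = 2 * R ^ 2 / (9 * c ^ 2) + R ^ 2 / (9 * c ^ 2) := by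
        field_simp; norm_num
      have h4 : (R ^ 2 + 1) / (3 * c) = R ^ 2 / (3 * c) + 1 / (3 * c) := by ring
      linarith
    have hdiff := exp_sub_exp_le ((R ^ 2 + 1) / (3 * c) + 2 * R ^ 2 / (9 * c ^ 2))
      (R ^ 2 / (3 * C))
    set e₁ := (R ^ 2 + 1) / (3 * c) + 2 * R ^ 2 / (9 * c ^ 2) with he₁
    rcases le_or_gt (3 * c) (R ^ 2) with hbig | hsmall
    · have : 1 / (3 * c) ≤ R ^ 2 / (9 * c ^ 2) := by
        rw [div_le_div_iff₀ (by positivity) (by positivity)]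
        nlinarith
      nlinarith [Real.exp_pos e₁]
    · have h1 : e₁ ≤ 1 + 1 := by
        have a1 : (R ^ 2 + 1) / (3 * c) ≤ 1 + 1 / 6 := by
          rw [div_le_iff₀ (by positivity)]; linarith
        have a2 : 2 * R ^ 2 / (9 * c ^ 2) ≤ 1 / 3 := by
          rw [div_le_iff₀ (by positivity)]; nlinarith
        linarith
      have h2 : e₁ - R ^ 2 / (3 * C) ≤ 1 / 6 := by
        have a1 : 1 / (3 * c) ≤ 1 / 6 := by
          rw [div_le_div_iff₀ (by positivity) (by positivity)]; linarith
        have a2 : 0 ≤ R ^ 2 / (9 * c ^ 2) := by positivity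
        linarith
      have h3 : Real.exp e₁ ≤ 9 := by
        refine (Real.exp_le_exp.mpr h1).trans ?_
        rw [Real.exp_add]
        nlinarith [Real.exp_pos 1]
      nlinarith [Real.exp_pos e₁]

/-- One round of AdaNormalHedge increases the potential of an expert by at most its weighted
instantaneous regret plus a constant multiple of its absolute instantaneous regret. -/
lemma anhPhi_add_le {R C d : ℝ} (hRC : |R| ≤ C) (hd : |d| ≤ 1) :
    anhPhi (R + d) (C + |d|) ≤ anhPhi R C + anhWeight R C * d + 3 / 2 * |d| := by
  have hC : 0 ≤ C := (abs_nonneg R).trans hRC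
  have havg := anhPhi_average_le hRC
  have hd0 := abs_nonneg d
  unfold anhWeight
  rcases le_total 0 d with h | h
  · rw [abs_of_nonneg h] at *
    have := anhPhi_interpolate_le (R' := R + 1) hC ((le_abs_self R).trans hRC) h hd
    rw [show (1 - d) * R + d * (R + 1) = R + d by ring] at this
    nlinarith
  · rw [abs_of_nonpos h] at *
    have := anhPhi_interpolate_le (R' := R - 1) hC ((le_abs_self R).trans hRC) hd0 hd
    rw [show (1 - -d) * R + -d * (R - 1) = R + d by ring] at this
    nlinarith

lemma ConvexOn.add_inner_gradient_le {E : Type*} [NormedAddCommGroup E] [InnerProductSpace ℝ E]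
    [CompleteSpace E] {f : E → ℝ} (hconv : ConvexOn ℝ Set.univ f) {x : E}
    (hdiff : DifferentiableAt ℝ f x) (y : E) :
    f x + inner ℝ (gradient f x) (y - x) ≤ f y := by
  have hc : ConvexOn ℝ Set.univ (f ∘ AffineMap.lineMap (k := ℝ) x y) := by
    simpa using hconv.comp_affineMap (AffineMap.lineMap (k := ℝ) x y)
  have hd : HasDerivAt (f ∘ AffineMap.lineMap x y) (fderiv ℝ f x (y - x)) (0 : ℝ) := by
    have hx : HasFDerivAt f (fderiv ℝ f x) (AffineMap.lineMap x y (0 : ℝ)) := by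
      simpa using hdiff.hasFDerivAt
    exact hx.comp_hasDerivAt 0 AffineMap.hasDerivAt_lineMap
  have := hc.le_slope_of_hasDerivAt (Set.mem_univ 0) (Set.mem_univ 1) zero_lt_one hd
  simp only [slope_def_field, Function.comp_apply, AffineMap.lineMap_apply_one,
    AffineMap.lineMap_apply_zero, sub_zero, div_one] at this
  rw [inner_gradient_left]
  linarith

/-- The self-bounding property of nonnegative convex smooth functions. -/
lemma norm_gradient_sq_le {E : Type*} [NormedAddCommGroup E] [InnerProductSpace ℝ E]
    [CompleteSpace E] {f : E → ℝ} (hconv : ConvexOn ℝ Set.univ f) (hdiff : Differentiable ℝ f)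
    (hnonneg : ∀ x, 0 ≤ f x) {H : ℝ} (hH : 0 ≤ H)
    (hsmooth : ∀ x y, ‖gradient f x - gradient f y‖ ≤ H * ‖x - y‖) (x : E) :
    ‖gradient f x‖ ^ 2 ≤ 4 * H * f x := by
  set g := gradient f x with hg
  have key : ∀ s : ℝ, 0 ≤ s → s * ‖g‖ ^ 2 - H * s ^ 2 * ‖g‖ ^ 2 ≤ f x := by
    intro s hs
    have h1 := hconv.add_inner_gradient_le (hdiff (x - s • g)) x
    have h2 := hnonneg (x - s • g)
    have h3 := hsmooth x (x - s • g)
    rw [sub_sub_cancel] at h1 h3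
    rw [norm_smul, Real.norm_of_nonneg hs, ← hg] at h3
    have h4 : inner ℝ (gradient f (x - s • g)) (s • g) =
        s * ‖g‖ ^ 2 - inner ℝ (g - gradient f (x - s • g)) (s • g) := by
      rw [inner_sub_left, inner_smul_right, inner_smul_right, real_inner_self_eq_norm_sq]
      ring
    have h5 := real_inner_le_norm (g - gradient f (x - s • g)) (s • g)
    rw [norm_smul, Real.norm_of_nonneg hs] at h5
    have h6 : 0 ≤ s * ‖g‖ := by positivity
    nlinarith [mul_le_mul_of_nonneg_right h3 h6]
  rcases hH.eq_or_lt with rfl | hH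
  · have hz : ‖g‖ ^ 2 = 0 := by
      by_contra hne
      have hpos : 0 < ‖g‖ ^ 2 := lt_of_le_of_ne (by positivity) (Ne.symm hne)
      have := key ((f x + 1) / ‖g‖ ^ 2) (div_nonneg (by linarith [hnonneg x]) hpos.le)
      rw [div_mul_cancel₀ _ hne] at this
      linarith
    simp [hz]
  · have := key (1 / (2 * H)) (by positivity)
    have h2 : 1 / (2 * H) * ‖g‖ ^ 2 - H * (1 / (2 * H)) ^ 2 * ‖g‖ ^ 2 = ‖g‖ ^ 2 / (4 * H) := by
      field_simp; ring
    rw [h2, div_le_iff₀ (by positivity)] at this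
    linarith

lemma norm_sub_le_of_isMinOn_norm_sub {E : Type*} [NormedAddCommGroup E]
    [InnerProductSpace ℝ E] {W : Set E} (hW : Convex ℝ W) {y p x : E} (hp : p ∈ W)
    (hmin : ∀ z ∈ W, ‖y - p‖ ≤ ‖y - z‖) (hx : x ∈ W) : ‖p - x‖ ≤ ‖y - x‖ := by
  have : Nonempty W := ⟨⟨p, hp⟩⟩
  have hinf : ‖y - p‖ = ⨅ w : W, ‖y - w‖ :=
    le_antisymm (le_ciInf fun w => hmin w w.2)
      (ciInf_le (f := fun w : W => ‖y - w‖) ⟨0, by rintro _ ⟨w, rfl⟩; positivity⟩ ⟨p, hp⟩)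
  have hin := (norm_eq_iInf_iff_real_inner_le_zero hW hp).mp hinf x hx
  have hexp : ‖y - x‖ ^ 2 = ‖y - p‖ ^ 2 - 2 * inner ℝ (y - p) (x - p) + ‖p - x‖ ^ 2 := by
    rw [norm_sub_rev p x, ← norm_sub_sq_real]
    congr 2
    abel
  refine le_of_sq_le_sq ?_ (norm_nonneg _)
  nlinarith [sq_nonneg ‖y - p‖]

/-- Linearized regret of online gradient descent with step sizes `α / √(δ + ∑ ‖g‖²)`. -/
lemma sogd_linear_regret {E : Type*} [NormedAddCommGroup E] [InnerProductSpace ℝ E]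
    {W : Set E} {D δ α : ℝ} (hdiam : ∀ x ∈ W, ∀ y ∈ W, ‖x - y‖ ≤ D) (hδ : 0 < δ)
    {proj : E → E} (hproj : ∀ y, ∀ x ∈ W, ‖proj y - x‖ ≤ ‖y - x‖)
    {w g : ℕ → E} (hw : ∀ k, w k ∈ W)
    (hrec : ∀ k, w (k + 1) =
      proj (w k - (α / Real.sqrt (δ + ∑ j ∈ Finset.range (k + 1), ‖g j‖ ^ 2)) • g k))
    {x : E} (hx : x ∈ W) (n : ℕ) :
    2 * α * ∑ k ∈ Finset.range n, inner ℝ (g k) (w k - x) ≤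
      (D ^ 2 + 2 * α ^ 2) * Real.sqrt (δ + ∑ k ∈ Finset.range n, ‖g k‖ ^ 2) := by
  suffices h : 2 * α * ∑ k ∈ Finset.range n, inner ℝ (g k) (w k - x) +
      Real.sqrt (δ + ∑ k ∈ Finset.range n, ‖g k‖ ^ 2) * ‖w n - x‖ ^ 2 ≤
      (D ^ 2 + 2 * α ^ 2) * Real.sqrt (δ + ∑ k ∈ Finset.range n, ‖g k‖ ^ 2) by
    have : 0 ≤ Real.sqrt (δ + ∑ k ∈ Finset.range n, ‖g k‖ ^ 2) * ‖w n - x‖ ^ 2 := by positivity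
    linarith
  have hD : ∀ k, ‖w k - x‖ ^ 2 ≤ D ^ 2 := fun k => by
    have := hdiam _ (hw k) _ hx
    gcongr
  induction n with
  | zero =>
    simp only [Finset.range_zero, Finset.sum_empty, mul_zero, add_zero, zero_add]
    nlinarith [hD 0, Real.sqrt_nonneg δ, mul_nonneg (Real.sqrt_nonneg δ) (sq_nonneg α)]
  | succ n ih =>
    have hnn : 0 ≤ ∑ k ∈ Finset.range n, ‖g k‖ ^ 2 := Finset.sum_nonneg fun _ _ => by positivity
    have hstep := hproj (w n -
      (α / Real.sqrt (δ + ∑ j ∈ Finset.range (n + 1), ‖g j‖ ^ 2)) • g n) x hx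
    rw [← hrec n] at hstep
    simp only [Finset.sum_range_succ] at hstep ⊢
    set G := ∑ k ∈ Finset.range n, ‖g k‖ ^ 2
    set A := Real.sqrt (δ + G) with hA
    set B := Real.sqrt (δ + (G + ‖g n‖ ^ 2)) with hB
    have hA2 : A ^ 2 = δ + G := Real.sq_sqrt (by linarith)
    have hB2 : B ^ 2 = δ + (G + ‖g n‖ ^ 2) := Real.sq_sqrt (by positivity)
    have hBpos : 0 < B := Real.sqrt_pos.mpr (by positivity)
    have hAB : A ≤ B := Real.sqrt_le_sqrt (by linarith [sq_nonneg ‖g n‖])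
    have hsq : ‖w (n + 1) - x‖ ^ 2 ≤ ‖w n - x‖ ^ 2 -
        2 * (α / B) * inner ℝ (g n) (w n - x) + (α / B) ^ 2 * ‖g n‖ ^ 2 := by
      calc ‖w (n + 1) - x‖ ^ 2 ≤ ‖w n - (α / B) • g n - x‖ ^ 2 := by gcongr
        _ = ‖(w n - x) - (α / B) • g n‖ ^ 2 := by congr 2; abel
        _ = _ := by
          rw [norm_sub_sq_real, inner_smul_right, real_inner_comm, norm_smul, mul_pow,
            Real.norm_eq_abs, sq_abs]
          ring
    have hsq' : B * ‖w (n + 1) - x‖ ^ 2 + 2 * α * inner ℝ (g n) (w n - x) ≤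
        B * ‖w n - x‖ ^ 2 + α ^ 2 * (‖g n‖ ^ 2 / B) := by
      have := mul_le_mul_of_nonneg_left hsq hBpos.le
      have e : B * (‖w n - x‖ ^ 2 - 2 * (α / B) * inner ℝ (g n) (w n - x) +
          (α / B) ^ 2 * ‖g n‖ ^ 2) = B * ‖w n - x‖ ^ 2 - 2 * α * inner ℝ (g n) (w n - x) +
          α ^ 2 * (‖g n‖ ^ 2 / B) := by
        field_simp
      linarith
    have hgB : ‖g n‖ ^ 2 / B ≤ 2 * (B - A) := by
      rw [div_le_iff₀ hBpos]
      nlinarith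
    nlinarith [mul_le_mul_of_nonneg_left hgB (sq_nonneg α),
      mul_le_mul_of_nonneg_left (hD n) (sub_nonneg.mpr hAB)]

lemma le_add_sqrt_of_sq_le {R a b : ℝ} (ha : 0 ≤ a) (hb : 0 ≤ b) (h : R ^ 2 ≤ a * R + b) :
    R ≤ a + Real.sqrt b := by
  by_contra! hlt
  nlinarith [Real.sq_sqrt hb, Real.sqrt_nonneg b]

/-- Combining the meta-regret `c + √(2cL)` with the expert regret, where `S` is the cumulative
loss of the algorithm, `L` that of the expert and `M` that of the comparator. -/
lemma regret_combine {S L M c k e : ℝ} (hc : 0 ≤ c) (hk : 0 ≤ k) (he : 0 ≤ e) (hM : 0 ≤ M)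
    (hmeta : S - L ≤ c + Real.sqrt (2 * c * L))
    (hexp : L - M ≤ 8 * k + e + Real.sqrt (8 * k * M)) :
    S - M ≤ 3 / 2 * c + 18 * k + 2 * e + Real.sqrt ((8 * c + 16 * k) * M) := by
  have hkM : 0 ≤ 8 * k * M := by positivity
  have h1 : Real.sqrt (8 * k * M) ≤ M + 2 * k :=
    Real.sqrt_le_iff.mpr ⟨by positivity, by nlinarith [sq_nonneg (M - 2 * k)]⟩
  have h2 : Real.sqrt (2 * c * L) ≤ Real.sqrt (4 * c * M) + (c / 2 + 10 * k + e) := by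
    rw [Real.sqrt_le_iff]
    refine ⟨by positivity, ?_⟩
    have hs := Real.sq_sqrt (show 0 ≤ 4 * c * M by positivity)
    have hL' : L ≤ 2 * M + (10 * k + e) := by linarith
    nlinarith [mul_nonneg (Real.sqrt_nonneg (4 * c * M))
      (show 0 ≤ c / 2 + 10 * k + e by positivity), sq_nonneg (c / 2 - (10 * k + e)),
      mul_le_mul_of_nonneg_left hL' (show 0 ≤ 2 * c by positivity)]
  have h3 : Real.sqrt (4 * c * M) + Real.sqrt (8 * k * M) ≤
      Real.sqrt ((8 * c + 16 * k) * M) := by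
    refine Real.le_sqrt_of_sq_le ?_
    have hs := Real.sq_sqrt (show 0 ≤ 4 * c * M by positivity)
    have ht := Real.sq_sqrt hkM
    nlinarith [sq_nonneg (Real.sqrt (4 * c * M) - Real.sqrt (8 * k * M))]
  linarith

lemma sqrt_add_sqrt_nat_mul_le (v : ℕ) {b x y : ℝ} (hb : 0 ≤ b) (hx : 0 ≤ x) (hy : 0 ≤ y) :
    Real.sqrt (b * x) + Real.sqrt (v * b * y) ≤ Real.sqrt (((v + 1 : ℕ) : ℝ) * b * (x + y)) := by
  refine Real.le_sqrt_of_sq_le ?_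
  have h1 : Real.sqrt (v * b * y) = Real.sqrt v * Real.sqrt (b * y) := by
    rw [mul_assoc, Real.sqrt_mul (by positivity)]
  have hv := Real.sq_sqrt (Nat.cast_nonneg (α := ℝ) v)
  have hbx := Real.sq_sqrt (mul_nonneg hb hx)
  have hby := Real.sq_sqrt (mul_nonneg hb hy)
  rw [h1]
  push_cast
  generalize Real.sqrt v = p at *
  generalize Real.sqrt (b * x) = q at *
  generalize Real.sqrt (b * y) = r at *
  have e : ((v : ℝ) + 1) * b * (x + y) = (p ^ 2 + 1) * (q ^ 2 + r ^ 2) := by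
    rw [hv, hbx, hby]; ring
  rw [e]
  nlinarith [sq_nonneg (p * q - r)]

lemma padicValNat_lt_padicValNat_cgcEnd_succ {i : ℕ} (hi : 1 ≤ i) :
    padicValNat 2 i < padicValNat 2 (i + 2 ^ padicValNat 2 i) := by
  obtain ⟨m, hm⟩ : 2 ^ padicValNat 2 i ∣ i := pow_padicValNat_dvd
  have hodd : ¬ 2 ∣ m := by
    rintro ⟨q, rfl⟩
    refine pow_succ_padicValNat_not_dvd (p := 2) (n := i) (by omega) ⟨q, ?_⟩
    rw [pow_succ, mul_assoc]
    exact hm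
  rw [Nat.lt_iff_add_one_le, ← padicValNat_dvd_iff_le (p := 2) (by positivity)]
  obtain ⟨q, hq⟩ : 2 ∣ m + 1 := by omega
  refine ⟨q, ?_⟩
  rw [pow_succ, mul_assoc, ← hq, mul_add, ← hm, mul_one]

lemma le_cgcEnd (i : ℕ) : i ≤ cgcEnd i := by
  have : 0 < 2 ^ padicValNat 2 i := by positivity
  unfold cgcEnd
  omega

lemma cgcEnd_add_one (i : ℕ) : cgcEnd i + 1 = i + 2 ^ padicValNat 2 i := by
  have : 0 < 2 ^ padicValNat 2 i := by positivity
  unfold cgcEnd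
  omega

/-- If `S t - M t` has regret `a + √(b ∑ M)` on every prefix `[i, t]` of a CGC interval, then it
has regret `v a + √(v b ∑ M)` on every `[r, s]`, for some `v` logarithmic in the length. -/
lemma exists_cgc_cover_regret {S M : ℕ → ℝ} {a b : ℝ} (hb : 0 ≤ b)
    (hM : ∀ t, 0 ≤ M t) (s : ℕ)
    (hcgc : ∀ i t, 1 ≤ i → i ≤ t → t ≤ cgcEnd i → t ≤ s →
      ∑ u ∈ Finset.Icc i t, (S u - M u) ≤ a + Real.sqrt (b * ∑ u ∈ Finset.Icc i t, M u))
    (r : ℕ) (hr : 1 ≤ r) (hrs : r ≤ s) :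
    ∃ v : ℕ, 2 ^ padicValNat 2 r * 2 ^ v ≤ s - r + 2 ^ padicValNat 2 r ∧
      ∑ t ∈ Finset.Icc r s, (S t - M t) ≤
        ((v + 1 : ℕ) : ℝ) * a +
          Real.sqrt (((v + 1 : ℕ) : ℝ) * b * ∑ t ∈ Finset.Icc r s, M t) := by
  induction hn : s - r using Nat.strong_induction_on generalizing r with
  | _ n ih =>
    subst hn
    rcases le_or_gt s (cgcEnd r) with hs | hs
    · refine ⟨0, by simp, ?_⟩
      simpa using hcgc r s hr hrs hs le_rfl
    · have hle := le_cgcEnd r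
      have hend := cgcEnd_add_one r
      obtain ⟨v, hv, hreg⟩ := ih (s - (cgcEnd r + 1)) (by omega) (cgcEnd r + 1) (by omega)
        (by omega) rfl
      refine ⟨v + 1, ?_, ?_⟩
      · have hlt := padicValNat_lt_padicValNat_cgcEnd_succ hr
        rw [← hend] at hlt
        have hpow : 2 ^ (padicValNat 2 r + 1) ≤ 2 ^ padicValNat 2 (cgcEnd r + 1) :=
          Nat.pow_le_pow_right (by norm_num) hlt
        obtain ⟨m, hm⟩ : ∃ m, 2 ^ v = m + 1 := Nat.exists_eq_add_of_le' Nat.one_le_two_pow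
        rw [hm, mul_add, mul_one] at hv
        rw [pow_succ] at hpow ⊢
        rw [hm]
        have h1 := Nat.mul_le_mul_right m hpow
        have h2 : s - r = s - (cgcEnd r + 1) + 2 ^ padicValNat 2 r := by omega
        rw [h2]
        nlinarith
      · have hsplit : ∀ F : ℕ → ℝ, ∑ t ∈ Finset.Icc r s, F t =
            ∑ t ∈ Finset.Icc r (cgcEnd r), F t + ∑ t ∈ Finset.Icc (cgcEnd r + 1) s, F t := by
          intro F
          rw [← Finset.sum_union]
          · congr 1
            ext t
            simp only [Finset.mem_Icc, Finset.mem_union]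
            omega
          · rw [Finset.disjoint_left]
            intro t
            simp only [Finset.mem_Icc]
            omega
        rw [hsplit, hsplit M]
        have h1 := hcgc r (cgcEnd r) hr hle le_rfl hs.le
        have h2 := sqrt_add_sqrt_nat_mul_le (v + 1) hb
          (Finset.sum_nonneg fun t (_ : t ∈ Finset.Icc r (cgcEnd r)) => hM t)
          (Finset.sum_nonneg fun t (_ : t ∈ Finset.Icc (cgcEnd r + 1) s) => hM t)
        push_cast at *
        linarith

lemma mem_activeSet {t i : ℕ} : i ∈ activeSet t ↔ 1 ≤ i ∧ i ≤ t ∧ t ≤ cgcEnd i := by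
  simp [activeSet, and_assoc]

lemma anh_state_bounds {ℓA : ℕ → ℝ} {ℓ Rg Cg : ℕ → ℕ → ℝ}
    (hA : ∀ t ≥ 1, 0 ≤ ℓA t)
    (hℓ : ∀ t, ∀ i ∈ activeSet t, 0 ≤ ℓ t i)
    (hR0 : ∀ i ≥ 1, Rg (i - 1) i = 0) (hC0 : ∀ i ≥ 1, Cg (i - 1) i = 0)
    (hR : ∀ t ≥ 1, ∀ i ∈ activeSet t, Rg t i = Rg (t - 1) i + ℓA t - ℓ t i)
    (hC : ∀ t ≥ 1, ∀ i ∈ activeSet t, Cg t i = Cg (t - 1) i + |ℓA t - ℓ t i|)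
    {i : ℕ} (hi : 1 ≤ i) {t : ℕ} (hit : i - 1 ≤ t) (ht : t ≤ cgcEnd i) :
    |Rg t i| ≤ Cg t i ∧ Rg t i = ∑ u ∈ Finset.Icc i t, (ℓA u - ℓ u i) ∧
      Cg t i ≤ Rg t i + 2 * ∑ u ∈ Finset.Icc i t, ℓ u i := by
  induction t, hit using Nat.le_induction with
  | base =>
    rw [hR0 i hi, hC0 i hi, Finset.Icc_eq_empty (by omega)]
    simp
  | succ t hit ih =>
    obtain ⟨h1, h2, h3⟩ := ih (by omega)
    have hmem : i ∈ activeSet (t + 1) := mem_activeSet.mpr ⟨hi, by omega, ht⟩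
    have e1 := hR (t + 1) (by omega) i hmem
    have e2 := hC (t + 1) (by omega) i hmem
    rw [Nat.add_sub_cancel] at e1 e2
    have hA' := hA (t + 1) (by omega)
    have hℓ' := hℓ (t + 1) i hmem
    have hd : |ℓA (t + 1) - ℓ (t + 1) i| ≤ ℓA (t + 1) + ℓ (t + 1) i :=
      abs_le.mpr ⟨by linarith, by linarith⟩
    rw [Finset.sum_Icc_succ_top (by omega), Finset.sum_Icc_succ_top (by omega), e1, e2]
    refine ⟨?_, by linarith, by linarith⟩
    rw [add_sub_assoc]
    exact (abs_add_le _ _).trans (by gcongr)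

/-- The total AdaNormalHedge potential of the first `t` experts is at most `4t²`. -/
lemma anh_potential_le {ℓA : ℕ → ℝ} {ℓ Rg Cg : ℕ → ℕ → ℝ}
    (hA : ∀ t ≥ 1, ℓA t ∈ Set.Icc (0 : ℝ) 1)
    (hℓ : ∀ t, ∀ i ∈ activeSet t, ℓ t i ∈ Set.Icc (0 : ℝ) 1)
    (hmix : ∀ t ≥ 1, ∑ i ∈ activeSet t,
      anhWeight (Rg (t - 1) i) (Cg (t - 1) i) * (ℓA t - ℓ t i) ≤ 0)
    (hR0 : ∀ i ≥ 1, Rg (i - 1) i = 0) (hC0 : ∀ i ≥ 1, Cg (i - 1) i = 0)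
    (hR : ∀ t ≥ 1, ∀ i ∈ activeSet t, Rg t i = Rg (t - 1) i + ℓA t - ℓ t i)
    (hC : ∀ t ≥ 1, ∀ i ∈ activeSet t, Cg t i = Cg (t - 1) i + |ℓA t - ℓ t i|) (t : ℕ) :
    ∑ i ∈ Finset.Icc 1 t, anhPhi (Rg (min t (cgcEnd i)) i) (Cg (min t (cgcEnd i)) i) ≤
      4 * (t : ℝ) ^ 2 := by
  induction t with
  | zero => simp
  | succ t ih =>
    have hnew : anhPhi (Rg (min t (cgcEnd (t + 1))) (t + 1))
        (Cg (min t (cgcEnd (t + 1))) (t + 1)) = 1 := by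
      have hle := le_cgcEnd (t + 1)
      have h1 := hR0 (t + 1) (by omega)
      have h2 := hC0 (t + 1) (by omega)
      rw [Nat.add_sub_cancel] at h1 h2
      rw [min_eq_left (by omega), h1, h2]
      simp [anhPhi]
    have hstep : ∀ i ∈ Finset.Icc 1 (t + 1),
        anhPhi (Rg (min (t + 1) (cgcEnd i)) i) (Cg (min (t + 1) (cgcEnd i)) i) ≤
          anhPhi (Rg (min t (cgcEnd i)) i) (Cg (min t (cgcEnd i)) i) +
          (if t + 1 ≤ cgcEnd i then anhWeight (Rg t i) (Cg t i) * (ℓA (t + 1) - ℓ (t + 1) i)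
            else 0) + 3 / 2 := by
      intro i hi
      obtain ⟨hi1, hit⟩ := Finset.mem_Icc.mp hi
      split_ifs with hend
      · rw [min_eq_left hend, min_eq_left (by omega)]
        have hmem : i ∈ activeSet (t + 1) := mem_activeSet.mpr ⟨hi1, hit, hend⟩
        have e1 := hR (t + 1) (by omega) i hmem
        have e2 := hC (t + 1) (by omega) i hmem
        rw [Nat.add_sub_cancel] at e1 e2
        have hA' := hA (t + 1) (by omega)
        have hℓ' := hℓ (t + 1) i hmem
        have hd : |ℓA (t + 1) - ℓ (t + 1) i| ≤ 1 :=
          abs_le.mpr ⟨by linarith [hA'.1, hℓ'.2], by linarith [hA'.2, hℓ'.1]⟩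
        have hst := (anh_state_bounds (fun t ht => (hA t ht).1) (fun t i hi => (hℓ t i hi).1)
          hR0 hC0 hR hC hi1 (t := t) (by omega) (by omega)).1
        have := anhPhi_add_le hst hd
        rw [e1, e2, add_sub_assoc]
        linarith
      · rw [min_eq_right (by omega), min_eq_right (by omega)]
        linarith
    refine (Finset.sum_le_sum hstep).trans ?_
    rw [Finset.sum_add_distrib, Finset.sum_add_distrib, ← Finset.sum_filter,
      Finset.sum_Icc_succ_top (by omega), hnew]
    have hmix' := hmix (t + 1) (by omega)
    rw [Nat.add_sub_cancel, activeSet] at hmix'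
    simp only [Finset.sum_const, Nat.card_Icc, nsmul_eq_mul]
    push_cast
    have : (0 : ℝ) ≤ t := Nat.cast_nonneg t
    nlinarith

/-- First-order regret of AdaNormalHedge with respect to an active expert. -/
lemma anh_regret {ℓA : ℕ → ℝ} {ℓ Rg Cg : ℕ → ℕ → ℝ}
    (hA : ∀ t ≥ 1, ℓA t ∈ Set.Icc (0 : ℝ) 1)
    (hℓ : ∀ t, ∀ i ∈ activeSet t, ℓ t i ∈ Set.Icc (0 : ℝ) 1)
    (hmix : ∀ t ≥ 1, ∑ i ∈ activeSet t,
      anhWeight (Rg (t - 1) i) (Cg (t - 1) i) * (ℓA t - ℓ t i) ≤ 0)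
    (hR0 : ∀ i ≥ 1, Rg (i - 1) i = 0) (hC0 : ∀ i ≥ 1, Cg (i - 1) i = 0)
    (hR : ∀ t ≥ 1, ∀ i ∈ activeSet t, Rg t i = Rg (t - 1) i + ℓA t - ℓ t i)
    (hC : ∀ t ≥ 1, ∀ i ∈ activeSet t, Cg t i = Cg (t - 1) i + |ℓA t - ℓ t i|)
    {i t : ℕ} (hi : 1 ≤ i) (hit : i ≤ t) (ht : t ≤ cgcEnd i) :
    ∑ u ∈ Finset.Icc i t, (ℓA u - ℓ u i) ≤ 3 * Real.log (4 * (t : ℝ) ^ 2) +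
      Real.sqrt (2 * (3 * Real.log (4 * (t : ℝ) ^ 2)) * ∑ u ∈ Finset.Icc i t, ℓ u i) := by
  obtain ⟨h1, h2, h3⟩ := anh_state_bounds (fun t ht => (hA t ht).1) (fun t i hi => (hℓ t i hi).1)
    hR0 hC0 hR hC hi (t := t) (by omega) ht
  have hsingle := (Finset.single_le_sum (f := fun j => anhPhi (Rg (min t (cgcEnd j)) j)
    (Cg (min t (cgcEnd j)) j)) (fun j _ => zero_le_one.trans (one_le_anhPhi _ _))
    (Finset.mem_Icc.mpr ⟨hi, hit⟩)).trans (anh_potential_le hA hℓ hmix hR0 hC0 hR hC t)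
  simp only [min_eq_left ht] at hsingle
  have ht1 : (1 : ℝ) ≤ t := by exact_mod_cast hi.trans hit
  have hlog : 0 ≤ Real.log (4 * (t : ℝ) ^ 2) := Real.log_nonneg (by nlinarith)
  have hL : 0 ≤ ∑ u ∈ Finset.Icc i t, ℓ u i := Finset.sum_nonneg fun u hu => by
    obtain ⟨hu1, hu2⟩ := Finset.mem_Icc.mp hu
    exact (hℓ u i (mem_activeSet.mpr ⟨hi, hu1, hu2.trans ht⟩)).1
  rw [← h2]
  set R := Rg t i
  set C := Cg t i
  rcases le_or_gt R 0 with hR | hR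
  · exact hR.trans (by positivity)
  · have hCpos : 0 < C := lt_of_lt_of_le (abs_pos.mpr hR.ne') h1
    rw [anhPhi_eq_exp hCpos.le, max_eq_left hR.le, ← Real.le_log_iff_exp_le (by positivity),
      div_le_iff₀ (by positivity)] at hsingle
    exact le_add_sqrt_of_sq_le (by positivity) (by positivity)
      (by nlinarith [mul_le_mul_of_nonneg_left h3 hlog])

/-- First-order regret of SOGD with `α = D / √2` for nonnegative convex smooth losses. -/
lemma sogd_regret {E : Type*} [NormedAddCommGroup E] [InnerProductSpace ℝ E] [CompleteSpace E]
    {W : Set E} {D H δ : ℝ} (hdiam : ∀ x ∈ W, ∀ y ∈ W, ‖x - y‖ ≤ D) (hD : 0 ≤ D)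
    {proj : E → E} (hproj : ∀ y, ∀ x ∈ W, ‖proj y - x‖ ≤ ‖y - x‖)
    {f : ℕ → E → ℝ} (hconv : ∀ t, ConvexOn ℝ Set.univ (f t))
    (hdiff : ∀ t, Differentiable ℝ (f t)) (hnonneg : ∀ t, ∀ x, 0 ≤ f t x) (hH : 0 ≤ H)
    (hsmooth : ∀ t, ∀ x y, ‖gradient (f t) x - gradient (f t) y‖ ≤ H * ‖x - y‖)
    (hδ : 0 < δ) {w : ℕ → E} (hw : ∀ k, w k ∈ W)
    (hrec : ∀ k, w (k + 1) = proj (w k - ((D / Real.sqrt 2) /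
      Real.sqrt (δ + ∑ j ∈ Finset.range (k + 1), ‖gradient (f j) (w j)‖ ^ 2)) •
        gradient (f k) (w k)))
    {x : E} (hx : x ∈ W) (n : ℕ) :
    ∑ k ∈ Finset.range n, f k (w k) - ∑ k ∈ Finset.range n, f k x ≤
      8 * (H * D ^ 2) + D * Real.sqrt (2 * δ) +
        Real.sqrt (8 * (H * D ^ 2) * ∑ k ∈ Finset.range n, f k x) := by
  have hM : 0 ≤ ∑ k ∈ Finset.range n, f k x := Finset.sum_nonneg fun k _ => hnonneg k x
  rcases hD.eq_or_lt with rfl | hD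
  · have : ∀ k, w k = x := fun k => by
      have := hdiam _ (hw k) _ hx
      exact sub_eq_zero.mp (norm_le_zero_iff.mp this)
    simp [this]
  have hlin := sogd_linear_regret hdiam hδ hproj (g := fun k => gradient (f k) (w k)) hw hrec hx n
  have hgrad : ∑ k ∈ Finset.range n, ‖gradient (f k) (w k)‖ ^ 2 ≤
      4 * H * ∑ k ∈ Finset.range n, f k (w k) := by
    rw [Finset.mul_sum]
    exact Finset.sum_le_sum fun k _ =>
      norm_gradient_sq_le (hconv k) (hdiff k) (hnonneg k) hH (hsmooth k) _
  have hcvx : ∑ k ∈ Finset.range n, f k (w k) - ∑ k ∈ Finset.range n, f k x ≤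
      ∑ k ∈ Finset.range n, inner ℝ (gradient (f k) (w k)) (w k - x) := by
    rw [← Finset.sum_sub_distrib]
    refine Finset.sum_le_sum fun k _ => ?_
    have := (hconv k).add_inner_gradient_le (hdiff k (w k)) x
    rw [← neg_sub (w k) x, inner_neg_right] at this
    linarith
  set L := ∑ k ∈ Finset.range n, f k (w k)
  set M := ∑ k ∈ Finset.range n, f k x
  set G := ∑ k ∈ Finset.range n, ‖gradient (f k) (w k)‖ ^ 2
  set I := ∑ k ∈ Finset.range n, inner ℝ (gradient (f k) (w k)) (w k - x)
  have hG : 0 ≤ G := Finset.sum_nonneg fun _ _ => by positivity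
  have hS := Real.sq_sqrt (show 0 ≤ δ + G by linarith)
  have hα : 2 * (D / Real.sqrt 2) ^ 2 = D ^ 2 := by
    rw [div_pow, Real.sq_sqrt (by norm_num)]
    ring
  have hα' : 2 * (D / Real.sqrt 2) = D * Real.sqrt 2 := by
    have := Real.sq_sqrt (show (0 : ℝ) ≤ 2 by norm_num)
    field_simp
    linarith
  rw [hα, hα'] at hlin
  have hI : I ≤ D * (Real.sqrt 2 * Real.sqrt (δ + G)) := by
    have h2 := Real.sq_sqrt (show (0 : ℝ) ≤ 2 by norm_num)
    have h2p : 0 < Real.sqrt 2 := by positivity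
    refine le_of_mul_le_mul_left ?_ (mul_pos hD h2p)
    calc D * Real.sqrt 2 * I ≤ (D ^ 2 + D ^ 2) * Real.sqrt (δ + G) := hlin
      _ = D ^ 2 * Real.sqrt 2 ^ 2 * Real.sqrt (δ + G) := by rw [h2]; ring
      _ = _ := by ring
  have hquad : 0 ≤ L - M → (L - M) ^ 2 ≤ 8 * (H * D ^ 2) * (L - M) +
      (2 * δ * D ^ 2 + 8 * (H * D ^ 2) * M) := by
    intro h0
    calc (L - M) ^ 2 ≤ (D * (Real.sqrt 2 * Real.sqrt (δ + G))) ^ 2 := by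
          gcongr
          exact hcvx.trans hI
      _ = 2 * D ^ 2 * (δ + G) := by
          rw [mul_pow, mul_pow, hS, Real.sq_sqrt (by norm_num)]
          ring
      _ ≤ 2 * D ^ 2 * (δ + 4 * H * L) := by gcongr
      _ = _ := by ring
  rcases le_or_gt 0 (L - M) with h0 | h0
  · refine (le_add_sqrt_of_sq_le (by positivity) (by positivity) (hquad h0)).trans ?_
    have h1 : Real.sqrt (2 * δ * D ^ 2 + 8 * (H * D ^ 2) * M) ≤
        Real.sqrt (2 * δ * D ^ 2) + Real.sqrt (8 * (H * D ^ 2) * M) := by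
      have ha := Real.sq_sqrt (show 0 ≤ 2 * δ * D ^ 2 by positivity)
      have hb := Real.sq_sqrt (show 0 ≤ 8 * (H * D ^ 2) * M by positivity)
      refine Real.sqrt_le_iff.mpr ⟨by positivity, ?_⟩
      nlinarith [mul_nonneg (Real.sqrt_nonneg (2 * δ * D ^ 2))
        (Real.sqrt_nonneg (8 * (H * D ^ 2) * M))]
    have h2 : Real.sqrt (2 * δ * D ^ 2) = D * Real.sqrt (2 * δ) := by
      rw [Real.sqrt_mul (by positivity), Real.sqrt_sq hD.le, mul_comm]
    linarith
  · exact h0.le.trans (by positivity)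

/-- Theorem 3 (adaptive regret of SACS): under Assumptions 1–4, with SOGD experts
(parameters `δ > 0`, `α = D/√2`) combined by the SACS meta-algorithm over the CGC
intervals, for any interval `[r, s] ⊆ [T]` and any `x ∈ W`, there is `v ≤ ⌈log₂(s − r + 2)⌉`
with `Σ_{t=r}^s (f t (wA t) − f t x) ≤ v·a(s) + √(v·b(s)·Σ_{t=r}^s f t x)`, where
`a(s) = (9/2) ln(4s²) + 18 H D² + 2D√(2δ)` and `b(s) = 24 ln(4s²) + 16 H D²`. -/
theorem stmt_4
    {E : Type*} [NormedAddCommGroup E] [InnerProductSpace ℝ E] [FiniteDimensional ℝ E]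
    (W : Set E) (hWne : W.Nonempty) (hWclosed : IsClosed W) (hWconvex : Convex ℝ W)
    -- `proj` is the metric projection onto `W`
    (proj : E → E)
    (hproj : ∀ x : E, proj x ∈ W ∧ ∀ y ∈ W, ‖x - proj x‖ ≤ ‖x - y‖)
    -- Assumption 1: the diameter of `W` is bounded by `D`
    (D : ℝ) (hdiam : ∀ x ∈ W, ∀ y ∈ W, ‖x - y‖ ≤ D)
    -- Assumption 2: the online functions are convex, differentiable and nonnegative on `E`
    (f : ℕ → E → ℝ)
    (hconv : ∀ t, ConvexOn ℝ Set.univ (f t))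
    (hdiff : ∀ t, Differentiable ℝ (f t))
    (hnonneg : ∀ t, ∀ x : E, 0 ≤ f t x)
    -- Assumption 3: the online functions are `H`-smooth
    (H : ℝ) (hH : 0 ≤ H)
    (hsmooth : ∀ t, ∀ x y : E,
      ‖gradient (f t) x - gradient (f t) y‖ ≤ H * ‖x - y‖)
    -- Assumption 4: the losses take values in `[0, 1]` on `W`
    (hbound : ∀ t, ∀ x ∈ W, f t x ∈ Set.Icc (0 : ℝ) 1)
    -- expert `E i` is an instance of SOGD (parameters `δ > 0`, `α = D/√2`) started at round `i`
    (δ : ℝ) (hδ : 0 < δ)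
    (wE : ℕ → ℕ → E)
    (hwE_init : ∀ i ≥ 1, wE i i ∈ W)
    (hwE_rec : ∀ i ≥ 1, ∀ t ≥ i, wE (t + 1) i =
      proj (wE t i - ((D / Real.sqrt 2) /
        Real.sqrt (δ + ∑ u ∈ Finset.Icc i t, ‖gradient (f u) (wE u i)‖ ^ 2)) •
          gradient (f t) (wE t i)))
    -- the SACS meta-algorithm
    (Rg Cg p : ℕ → ℕ → ℝ) (wA : ℕ → E)
    (hR0 : ∀ i ≥ 1, Rg (i - 1) i = 0)
    (hC0 : ∀ i ≥ 1, Cg (i - 1) i = 0)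
    (hp : ∀ t ≥ 1, ∀ i ∈ activeSet t,
      p t i = anhWeight (Rg (t - 1) i) (Cg (t - 1) i)
        / ∑ j ∈ activeSet t, anhWeight (Rg (t - 1) j) (Cg (t - 1) j))
    (hwA : ∀ t ≥ 1, wA t = ∑ i ∈ activeSet t, p t i • wE t i)
    (hRrec : ∀ t ≥ 1, ∀ i ∈ activeSet t,
      Rg t i = Rg (t - 1) i + f t (wA t) - f t (wE t i))
    (hCrec : ∀ t ≥ 1, ∀ i ∈ activeSet t,
      Cg t i = Cg (t - 1) i + |f t (wA t) - f t (wE t i)|)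
    -- an interval `[r, s] ⊆ [T]` and a comparator `x ∈ W`
    (T r s : ℕ) (hr : 1 ≤ r) (hrs : r ≤ s) (hsT : s ≤ T)
    (x : E) (hx : x ∈ W) :
    ∃ v : ℕ, v ≤ Nat.clog 2 (s - r + 2) ∧
      ∑ t ∈ Finset.Icc r s, (f t (wA t) - f t x)
        ≤ (v : ℝ) * (9 / 2 * Real.log (4 * (s : ℝ) ^ 2) + 18 * H * D ^ 2
              + 2 * D * Real.sqrt (2 * δ))
          + Real.sqrt ((v : ℝ) * (24 * Real.log (4 * (s : ℝ) ^ 2) + 16 * H * D ^ 2)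
              * ∑ t ∈ Finset.Icc r s, f t x) := by
  have hD : 0 ≤ D := (norm_nonneg (x - x)).trans (hdiam x hx x hx)
  have hprojW : ∀ y, ∀ z ∈ W, ‖proj y - z‖ ≤ ‖y - z‖ := fun y z hz =>
    norm_sub_le_of_isMinOn_norm_sub hWconvex (hproj y).1 (hproj y).2 hz
  have hwE : ∀ i ≥ 1, ∀ t, i ≤ t → wE t i ∈ W := by
    intro i hi t hit
    rcases hit.eq_or_lt with rfl | hlt
    · exact hwE_init _ hi
    · obtain ⟨u, rfl⟩ : ∃ u, t = u + 1 := ⟨t - 1, by omega⟩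
      rw [hwE_rec i hi u (by omega)]
      exact (hproj _).1
  have hactive : ∀ t, ∀ i ∈ activeSet t, wE t i ∈ W := fun t i hi =>
    hwE i (mem_activeSet.mp hi).1 t (mem_activeSet.mp hi).2.1
  have hpos : ∀ t ≥ 1, 0 < ∑ j ∈ activeSet t, anhWeight (Rg (t - 1) j) (Cg (t - 1) j) := by
    intro t ht
    refine Finset.sum_pos' (fun _ _ => anhWeight_nonneg _ _)
      ⟨t, mem_activeSet.mpr ⟨ht, le_rfl, le_cgcEnd t⟩, ?_⟩
    rw [hR0 t ht, hC0 t ht]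
    exact anhWeight_zero_zero_pos
  have hcenter : ∀ t ≥ 1, wA t = (activeSet t).centerMass
      (fun i => anhWeight (Rg (t - 1) i) (Cg (t - 1) i)) (wE t) := by
    intro t ht
    rw [hwA t ht, Finset.centerMass, Finset.smul_sum]
    refine Finset.sum_congr rfl fun i hi => ?_
    rw [hp t ht i hi, smul_smul, div_eq_inv_mul]
  have hwAW : ∀ t ≥ 1, wA t ∈ W := fun t ht => by
    rw [hcenter t ht]
    exact hWconvex.centerMass_mem (fun _ _ => anhWeight_nonneg _ _) (hpos t ht) (hactive t)
  have hmix : ∀ t ≥ 1, ∑ i ∈ activeSet t,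
      anhWeight (Rg (t - 1) i) (Cg (t - 1) i) * (f t (wA t) - f t (wE t i)) ≤ 0 := by
    intro t ht
    have hjensen := (hconv t).map_centerMass_le (fun _ _ => anhWeight_nonneg _ _) (hpos t ht)
      (fun i (_ : i ∈ activeSet t) => Set.mem_univ (wE t i))
    rw [← hcenter t ht, Finset.centerMass, smul_eq_mul, ← div_eq_inv_mul,
      le_div_iff₀ (hpos t ht), Finset.mul_sum] at hjensen
    simp only [smul_eq_mul, Function.comp_apply] at hjensen
    rw [← sub_nonpos, ← Finset.sum_sub_distrib] at hjensen
    refine le_trans (le_of_eq (Finset.sum_congr rfl fun i _ => ?_)) hjensen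
    ring
  have hk : 0 ≤ H * D ^ 2 := by positivity
  have hprefix : ∀ i t, 1 ≤ i → i ≤ t → t ≤ cgcEnd i → t ≤ s →
      ∑ u ∈ Finset.Icc i t, (f u (wA u) - f u x) ≤
        (9 / 2 * Real.log (4 * (s : ℝ) ^ 2) + 18 * H * D ^ 2 + 2 * D * Real.sqrt (2 * δ)) +
        Real.sqrt ((24 * Real.log (4 * (s : ℝ) ^ 2) + 16 * H * D ^ 2) *
          ∑ u ∈ Finset.Icc i t, f u x) := by
    intro i t hi hit ht hts
    have hmeta := anh_regret (ℓA := fun t => f t (wA t)) (ℓ := fun t i => f t (wE t i))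
      (fun t ht => hbound t _ (hwAW t ht)) (fun t i hi => hbound t _ (hactive t i hi)) hmix
      hR0 hC0 hRrec hCrec hi hit ht
    have hshift : ∀ (F : ℕ → ℝ) (m : ℕ), ∑ u ∈ Finset.Icc i (i + m), F u =
        ∑ k ∈ Finset.range (m + 1), F (i + k) := by
      intro F m
      rw [← Finset.Ico_add_one_right_eq_Icc, Finset.sum_Ico_eq_sum_range]
      congr 2
      omega
    obtain ⟨m, rfl⟩ := Nat.exists_eq_add_of_le hit
    have hexp := sogd_regret hdiam hD hprojW (f := fun k => f (i + k)) (fun k => hconv _)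
      (fun k => hdiff _) (fun k => hnonneg _) hH (fun k => hsmooth _) hδ
      (w := fun k => wE (i + k) i) (fun k => hwE i hi _ (by omega))
      (fun k => by
        have := hwE_rec i hi (i + k) (by omega)
        rwa [hshift] at this) hx (m + 1)
    rw [← hshift (fun u => f u (wE u i)), ← hshift (fun u => f u x)] at hexp
    have him : (1 : ℝ) ≤ (i + m : ℕ) := by exact_mod_cast hi.trans hit
    have hims : ((i + m : ℕ) : ℝ) ≤ s := by exact_mod_cast hts
    have hlog0 : 0 ≤ Real.log (4 * ((i + m : ℕ) : ℝ) ^ 2) := Real.log_nonneg (by nlinarith)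
    have hlog : Real.log (4 * ((i + m : ℕ) : ℝ) ^ 2) ≤ Real.log (4 * (s : ℝ) ^ 2) :=
      Real.log_le_log (by positivity) (by gcongr)
    have hM : 0 ≤ ∑ u ∈ Finset.Icc i (i + m), f u x :=
      Finset.sum_nonneg fun u _ => hnonneg u x
    rw [Finset.sum_sub_distrib] at hmeta ⊢
    have hcomb := regret_combine (mul_nonneg (by norm_num : (0 : ℝ) ≤ 3) hlog0) hk
      (mul_nonneg hD (Real.sqrt_nonneg _)) hM hmeta hexp
    have hsqrt : Real.sqrt ((8 * (3 * Real.log (4 * ((i + m : ℕ) : ℝ) ^ 2)) +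
        16 * (H * D ^ 2)) * ∑ u ∈ Finset.Icc i (i + m), f u x) ≤
        Real.sqrt ((24 * Real.log (4 * (s : ℝ) ^ 2) + 16 * H * D ^ 2) *
          ∑ u ∈ Finset.Icc i (i + m), f u x) := by
      refine Real.sqrt_le_sqrt (mul_le_mul_of_nonneg_right ?_ hM)
      linarith
    linarith
  have hs1 : (1 : ℝ) ≤ s := by exact_mod_cast hr.trans hrs
  have hlog : 0 ≤ Real.log (4 * (s : ℝ) ^ 2) := Real.log_nonneg (by nlinarith)
  obtain ⟨v, hv, hreg⟩ := exists_cgc_cover_regret (S := fun t => f t (wA t))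
    (M := fun t => f t x) (by linarith) (fun t => hnonneg t x) s hprefix r hr hrs
  refine ⟨v + 1, ?_, hreg⟩
  rw [Nat.add_one_le_iff, Nat.lt_clog_iff_pow_lt one_lt_two]
  obtain ⟨a, ha⟩ : ∃ a, 2 ^ v = a + 1 := Nat.exists_eq_add_of_le' Nat.one_le_two_pow
  have hk1 : 1 ≤ 2 ^ padicValNat 2 r := Nat.one_le_two_pow
  rw [ha] at hv ⊢
  nlinarith [Nat.mul_le_mul_right a hk1]
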